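/- Let m₊⁽¹⁾, m₊⁽²⁾, m₋⁽¹⁾, m₋⁽²⁾ ≥ 0 be integers, not all zero, and set p = [2(m₊⁽¹⁾+m₊⁽²⁾)+1] ⊔ [2|m₊⁽¹⁾−m₊⁽²⁾|−1] ⊔ [2(m₋⁽¹⁾+m₋⁽²⁾)−1] ⊔ [2|m₋⁽¹⁾−m₋⁽²⁾|−1]. For i = 1, 2 set W_i = [2(m₊⁽ⁱ⁾+m₋⁽ⁱ⁾)] ⊔ [2(m₊⁽ⁱ⁾−m₋⁽ⁱ⁾)] if m₊⁽ⁱ⁾ ≥ m₋⁽ⁱ⁾, and W_i = [2(m₊⁽ⁱ⁾+m₋⁽ⁱ⁾)] ⊔ [2(m₋⁽ⁱ⁾−m₊⁽ⁱ⁾−1)] if m₊⁽ⁱ⁾ < m₋⁽ⁱ⁾. Then W₁ ⊔ W₂ ≤ ((pᵗ)⁻)_C in the dominance order. -/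

import Mathlib

/-- A partition: a finite multiset of positive integers. -/
def IsPartition (p : Multiset ℕ) : Prop := ∀ x ∈ p, 0 < x

/-- The parts of `p` in weakly decreasing order. -/
def descList (p : Multiset ℕ) : List ℕ := (p.sort (· ≤ ·)).reverse

/-- The sum of the `j` largest parts of `p` (padding with trailing zeros). -/
def topSum (p : Multiset ℕ) (j : ℕ) : ℕ := ((descList p).take j).sum

/-- Dominance order: `DomLE α β` means `α ≤ β`, i.e. each partial sum of the
largest parts of `α` is at most the corresponding partial sum for `β`. -/
def DomLE (α β : Multiset ℕ) : Prop := ∀ j : ℕ, topSum α j ≤ topSum β j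

/-- Transpose of a partition: the `j`-th part is the number of parts `≥ j`. -/
def transposeP (p : Multiset ℕ) : Multiset ℕ :=
  ((Multiset.range p.sum).map fun j => (p.filter fun x => j + 1 ≤ x).card).filter
    fun c => c ≠ 0

/-- The weakly decreasing list of parts padded with zeros to length `n`. -/
def padDesc (p : Multiset ℕ) (n : ℕ) : List ℕ :=
  descList p ++ List.replicate (n - Multiset.card p) 0

/-- The sum of two partitions: add the parts pointwise after sorting in
weakly decreasing order and padding with trailing zeros. -/
def sumParts (p q : Multiset ℕ) : Multiset ℕ :=
  (↑(List.zipWith (· + ·)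
      (padDesc p (max (Multiset.card p) (Multiset.card q)))
      (padDesc q (max (Multiset.card p) (Multiset.card q)))) : Multiset ℕ).filter
    fun x => x ≠ 0

/-- The string `[a] = (a, a-2, a-4, …, 2 or 1)`, empty for `a = 0`. -/
def strP (a : ℕ) : Multiset ℕ := (Multiset.range ((a + 1) / 2)).map fun k => a - 2 * k

/-- The partition `(a, a-1, …, 2, 1)`. -/
def downP (a : ℕ) : Multiset ℕ := (Multiset.range a).map fun k => a - k

/-- The partition `(2a-1, 2a-3, …, 3, 1)`. -/
def oddsDown (a : ℕ) : Multiset ℕ := (Multiset.range a).map fun k => 2 * (a - k) - 1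

/-- The partition `(2a, 2a-2, …, 4, 2)`. -/
def evensDown (a : ℕ) : Multiset ℕ := (Multiset.range a).map fun k => 2 * (a - k)

/-- `p⁻`: decrease the smallest part of `p` by 1 (deleting it if it was 1). -/
def pMinus (p : Multiset ℕ) : Multiset ℕ :=
  match p.sort (· ≤ ·) with
  | [] => 0
  | a :: rest => (↑rest : Multiset ℕ) + (if a ≤ 1 then 0 else {a - 1})

/-- A partition is symplectic if every odd part occurs with even multiplicity. -/
def IsSymplectic (p : Multiset ℕ) : Prop := ∀ x : ℕ, Odd x → Even (p.count x)

/-- A partition is orthogonal if every even part occurs with even multiplicity. -/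
def IsOrthogonal (p : Multiset ℕ) : Prop := ∀ x : ℕ, Even x → Even (p.count x)

/-- `IsCCollapse p q`: `q` is the C-collapse `p_C` of `p`, i.e. the unique maximal
symplectic partition of the same total that is `≤ p` in the dominance order. -/
def IsCCollapse (p q : Multiset ℕ) : Prop :=
  IsPartition q ∧ IsSymplectic q ∧ q.sum = p.sum ∧ DomLE q p ∧
    ∀ r : Multiset ℕ, IsPartition r → IsSymplectic r → r.sum = p.sum → DomLE r p → DomLE r q

theorem List.Sublist.sum_le_sum_take {l L : List ℕ} (h : l.Sublist L)
    (hL : L.Pairwise (· ≥ ·)) {j : ℕ} (hj : l.length ≤ j) : l.sum ≤ (L.take j).sum := by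
  induction L generalizing l j with
  | nil => simp [List.sublist_nil.1 h]
  | cons b L ih =>
    rw [List.pairwise_cons] at hL
    match l, j, hj with
    | [], _, _ => simp
    | c :: l, j + 1, hj =>
      have hc : c ≤ b := by
        rcases List.mem_cons.1 (h.subset List.mem_cons_self) with rfl | hc
        · exact le_rfl
        · exact hL.1 c hc
      have := ih (l := l) (j := j) (by simpa using h.tail) hL.2 (by simpa using hj)
      rw [List.take_succ_cons, List.sum_cons, List.sum_cons]
      omega

theorem coe_descList (p : Multiset ℕ) : (descList p : Multiset ℕ) = p := by
  simp [descList, Multiset.coe_reverse]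

theorem pairwise_descList (p : Multiset ℕ) : (descList p).Pairwise (· ≥ ·) := by
  rw [descList, List.pairwise_reverse]
  exact Multiset.pairwise_sort p (· ≤ ·)

/-- `topSum q j` bounds the sum of every choice of at most `j` parts of `q`. -/
theorem sum_le_topSum {T q : Multiset ℕ} (h : T ≤ q) {j : ℕ} (hj : T.card ≤ j) :
    T.sum ≤ topSum q j := by
  induction T using Quotient.inductionOn with
  | h l =>
    rw [← coe_descList q] at h
    obtain ⟨l', hp, hs⟩ := Multiset.coe_le.1 h
    have := hs.sum_le_sum_take (pairwise_descList q) (j := j)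
      (by rw [hp.length_eq]; simpa using hj)
    rw [hp.sum_eq] at this
    simpa [topSum] using this

/-- `topSum q j` is the sum of some choice of at most `j` parts of `q`. -/
theorem exists_le_sum_eq_topSum (q : Multiset ℕ) (j : ℕ) :
    ∃ T ≤ q, T.card ≤ j ∧ T.sum = topSum q j := by
  refine ⟨((descList q).take j : List ℕ), ?_, ?_, ?_⟩
  · conv_rhs => rw [← coe_descList q]
    exact Multiset.coe_le.2 (List.take_sublist _ _).subperm
  · simp
  · simp [topSum]

theorem Multiset.exists_add_eq_of_le_add {T S₁ S₂ : Multiset ℕ} (h : T ≤ S₁ + S₂) :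
    ∃ T₁ ≤ S₁, ∃ T₂ ≤ S₂, T = T₁ + T₂ := by
  refine ⟨T ∩ S₁, Multiset.inter_le_right, T - S₁, ?_, ?_⟩
  · rw [tsub_le_iff_left]; exact h
  · ext x
    simp only [Multiset.count_add, Multiset.count_inter, Multiset.count_sub]
    omega

theorem sum_map_range_card_filter (p : Multiset ℕ) (n : ℕ) :
    ((Multiset.range n).map fun j => (p.filter fun x => j + 1 ≤ x).card).sum =
      (p.map fun x => min x n).sum := by
  induction n with
  | zero => simp
  | succ n ih =>
    rw [Multiset.range_succ, Multiset.map_cons, Multiset.sum_cons, ih]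
    clear ih
    induction p using Multiset.induction_on with
    | empty => simp
    | cons x p ih =>
      rw [Multiset.filter_cons, Multiset.card_add, Multiset.map_cons, Multiset.map_cons,
        Multiset.sum_cons, Multiset.sum_cons, ← add_assoc] at *
      split_ifs with hx <;> simp only [Multiset.card_singleton, Multiset.card_zero] <;> omega

theorem Multiset.sum_filter_ne_zero (s : Multiset ℕ) : (s.filter fun c => c ≠ 0).sum = s.sum := by
  induction s using Multiset.induction_on with
  | empty => simp
  | cons x s ih =>
    by_cases hx : x = 0 <;> simp_all

theorem sum_transposeP (p : Multiset ℕ) : (transposeP p).sum = p.sum := by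
  rw [transposeP, Multiset.sum_filter_ne_zero, sum_map_range_card_filter]
  have : (p.map fun x => min x p.sum) = p.map id :=
    Multiset.map_congr rfl fun x hx => min_eq_left (Multiset.le_sum_of_mem hx)
  rw [this, Multiset.map_id]

theorem isPartition_transposeP (p : Multiset ℕ) : IsPartition (transposeP p) := by
  intro x hx
  exact Nat.pos_of_ne_zero (Multiset.mem_filter.1 hx).2

theorem sum_min_le_topSum_transposeP (p : Multiset ℕ) (j : ℕ) :
    (p.map fun x => min x j).sum ≤ topSum (transposeP p) j := by
  have h : (p.map fun x => min x j) = p.map fun x => min x (min j p.sum) :=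
    Multiset.map_congr rfl fun x hx => by
      have := Multiset.le_sum_of_mem hx
      omega
  rw [h, ← sum_map_range_card_filter, ← Multiset.sum_filter_ne_zero]
  apply sum_le_topSum
  · exact Multiset.filter_le_filter _
      (Multiset.map_le_map (Multiset.range_le.2 (min_le_right _ _)))
  · refine (Multiset.card_le_card (Multiset.filter_le _ _)).trans ?_
    simp

theorem sum_pMinus {P : Multiset ℕ} (hP : IsPartition P) : (pMinus P).sum = P.sum - 1 := by
  have hs := Multiset.sort_eq P (· ≤ ·)
  rw [pMinus]
  cases hl : P.sort (· ≤ ·) with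
  | nil => rw [hl] at hs; simp [← hs]
  | cons a rest =>
    rw [hl] at hs
    have ha : 0 < a := hP a (by rw [← hs]; simp)
    have : P.sum = a + rest.sum := by rw [← hs]; simp
    simp only [Multiset.sum_add, Multiset.sum_coe]
    split_ifs <;> simp <;> omega

theorem min_topSum_le_topSum_pMinus {P : Multiset ℕ} (hP : IsPartition P) (j : ℕ) :
    min (topSum P j) (P.sum - 1) ≤ topSum (pMinus P) j := by
  by_cases hj : (pMinus P).card ≤ j
  · rw [← sum_pMinus hP]
    exact (min_le_right _ _).trans (sum_le_topSum le_rfl hj)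
  · refine (min_le_left _ _).trans ?_
    rw [topSum, descList]
    rw [pMinus] at hj ⊢
    cases hl : P.sort (· ≤ ·) with
    | nil => simp
    | cons a rest =>
      simp only [hl] at hj ⊢
      have hj' : j ≤ rest.reverse.length := by
        rw [Multiset.card_add] at hj
        split_ifs at hj <;> simp at hj ⊢ <;> omega
      rw [List.reverse_cons, List.take_append_of_le_length hj', ← Multiset.sum_coe]
      apply sum_le_topSum
      · refine le_trans ?_ (Multiset.le_add_right _ _)
        rw [← Multiset.coe_reverse rest]
        exact Multiset.coe_le.2 (List.take_sublist _ _).subperm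
      · simp

theorem strP_add_two (a : ℕ) : strP (a + 2) = (a + 2) ::ₘ strP a := by
  have h : (a + 2 + 1) / 2 = (a + 1) / 2 + 1 := by omega
  simp only [strP, h, Multiset.range, Multiset.map_coe, List.range_succ_eq_map, List.map_cons,
    List.map_map, Multiset.cons_coe]
  congr 2
  apply List.map_congr_left
  intro k _
  simp only [Function.comp]
  omega

theorem strP_even_succ (A : ℕ) : strP (2 * (A + 1)) = (2 * A + 2) ::ₘ strP (2 * A) :=
  strP_add_two (2 * A)

theorem strP_odd_succ (k : ℕ) : strP (2 * (k + 1) - 1) = (2 * k + 1) ::ₘ strP (2 * k - 1) := by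
  cases k with
  | zero => rfl
  | succ k => exact strP_add_two (2 * k + 1)

theorem sum_strP_even (A : ℕ) : (strP (2 * A)).sum = A * (A + 1) := by
  induction A with
  | zero => rfl
  | succ A ih => rw [strP_even_succ, Multiset.sum_cons, ih]; ring

theorem sum_strP_odd (k : ℕ) : (strP (2 * k - 1)).sum = k ^ 2 := by
  induction k with
  | zero => rfl
  | succ k ih => rw [strP_odd_succ, Multiset.sum_cons, ih]; ring

theorem even_pos_of_mem_strP_even {A x : ℕ} (hx : x ∈ strP (2 * A)) : Even x ∧ 0 < x := by
  induction A with
  | zero => simp [strP] at hx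
  | succ A ih =>
    rw [strP_even_succ, Multiset.mem_cons] at hx
    rcases hx with rfl | hx
    · exact ⟨⟨A + 1, by ring⟩, by omega⟩
    · exact ih hx

theorem sum_add_card_sq_le_of_le_strP_even {A : ℕ} {T : Multiset ℕ} (h : T ≤ strP (2 * A)) :
    T.sum + T.card * T.card ≤ T.card * (2 * A + 1) := by
  induction A generalizing T with
  | zero =>
    have : T = 0 := by simpa [strP] using h
    simp [this]
  | succ A ih =>
    rw [strP_even_succ] at h
    by_cases hm : 2 * A + 2 ∈ T
    · obtain ⟨T, rfl⟩ := Multiset.exists_cons_of_mem hm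
      have := ih ((Multiset.cons_le_cons_iff _).1 h)
      rw [Multiset.sum_cons, Multiset.card_cons]
      linarith
    · have := ih ((Multiset.le_cons_of_notMem hm).1 h)
      linarith

theorem sum_min_strP_odd_of_le {k j : ℕ} (h : 2 * k ≤ j + 1) :
    ((strP (2 * k - 1)).map fun x => min x j).sum = k ^ 2 := by
  rw [← sum_strP_odd]
  congr 1
  conv_rhs => rw [← Multiset.map_id (strP (2 * k - 1))]
  refine Multiset.map_congr rfl fun x hx => min_eq_left ?_
  obtain ⟨i, -, rfl⟩ := Multiset.mem_map.1 hx
  omega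

theorem exists_sum_min_strP_odd (k j : ℕ) :
    ∃ u : ℕ, (((strP (2 * k - 1)).map fun x => min x j).sum : ℤ) = j * u + ((k : ℤ) - u) ^ 2 := by
  induction k with
  | zero => exact ⟨0, by simp [strP]⟩
  | succ k ih =>
    by_cases hk : 2 * (k + 1) ≤ j + 1
    · exact ⟨0, by rw [sum_min_strP_odd_of_le hk]; simp⟩
    · obtain ⟨u, hu⟩ := ih
      refine ⟨u + 1, ?_⟩
      rw [strP_odd_succ, Multiset.map_cons, Multiset.sum_cons, Nat.cast_add, hu,
        min_eq_right (by omega)]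
      push_cast
      ring

/-- The parts of `W` attached to a single pair `(m₊, m₋)`. -/
def pairPart (mp mm : ℕ) : Multiset ℕ :=
  if mm ≤ mp then strP (2 * (mp + mm)) + strP (2 * (mp - mm))
  else strP (2 * (mp + mm)) + strP (2 * (mm - mp - 1))

theorem even_pos_of_mem_pairPart {mp mm x : ℕ} (hx : x ∈ pairPart mp mm) : Even x ∧ 0 < x := by
  rw [pairPart] at hx
  split_ifs at hx <;> rcases Multiset.mem_add.1 hx with hx | hx <;>
    exact even_pos_of_mem_strP_even hx

theorem sum_pairPart (mp mm : ℕ) : (pairPart mp mm).sum = 2 * (mp ^ 2 + mm ^ 2 + mp) := by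
  rw [pairPart]
  split_ifs with h
  · obtain ⟨d, rfl⟩ := Nat.exists_eq_add_of_le h
    rw [Multiset.sum_add, sum_strP_even, sum_strP_even, Nat.add_sub_cancel_left]
    ring
  · obtain ⟨d, rfl⟩ := Nat.exists_eq_add_of_lt (not_le.1 h)
    rw [Multiset.sum_add, sum_strP_even, sum_strP_even,
      show mp + d + 1 - mp - 1 = d by omega]
    ring

theorem exists_sum_le_of_le_pairPart {mp mm : ℕ} {T : Multiset ℕ} (h : T ≤ pairPart mp mm) :
    ∃ (a b : ℕ) (ε : ℤ), (ε = 1 ∨ ε = -1) ∧ T.card = a + b ∧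
      (T.sum : ℤ) ≤ a * (2 * (mp + mm) + 1 - a) + b * (ε * (2 * (mp - mm) + 1) - b) := by
  rw [pairPart] at h
  split_ifs at h with hle <;> obtain ⟨T₁, h₁, T₂, h₂, rfl⟩ := Multiset.exists_add_eq_of_le_add h <;>
    have h₁ := sum_add_card_sq_le_of_le_strP_even h₁ <;>
    have h₂ := sum_add_card_sq_le_of_le_strP_even h₂
  · refine ⟨T₁.card, T₂.card, 1, Or.inl rfl, Multiset.card_add _ _, ?_⟩
    rw [Multiset.sum_add]
    zify [hle] at h₁ h₂ ⊢
    linarith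
  · refine ⟨T₁.card, T₂.card, -1, Or.inr rfl, Multiset.card_add _ _, ?_⟩
    rw [Multiset.sum_add]
    obtain ⟨d, rfl⟩ := Nat.exists_eq_add_of_lt (not_le.1 hle)
    rw [show mp + d + 1 - mp - 1 = d by omega] at h₂
    zify at h₁ h₂ ⊢
    linarith

theorem exists_sign_mul_eq_max_sub_min (x y : ℕ) :
    ∃ ε : ℤ, (ε = 1 ∨ ε = -1) ∧ ((max x y - min x y : ℕ) : ℤ) = ε * (x - y) := by
  rcases le_total x y with h | h
  · exact ⟨-1, Or.inr rfl, by rw [max_eq_right h, min_eq_left h]; push_cast [h]; ring⟩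
  · exact ⟨1, Or.inl rfl, by rw [max_eq_left h, min_eq_right h]; push_cast [h]; ring⟩

/-- Setting `θ` to be half the Hadamard transform of `(u₁, ε₃ u₂, u₃, ε₄ u₄)`, the difference of
the two sides is a sum of squares `(X - a - θ) ^ 2` and of products of nonnegative numbers. -/
theorem quadratic_bound {x₁ x₂ m₁ m₂ a b c d u₁ u₂ u₃ u₄ j ε₁ ε₂ ε₃ ε₄ : ℤ}
    (ha : 0 ≤ a) (hb : 0 ≤ b) (hc : 0 ≤ c) (hd : 0 ≤ d)
    (h₁ : 0 ≤ u₁) (h₂ : 0 ≤ u₂) (h₃ : 0 ≤ u₃) (h₄ : 0 ≤ u₄) (hj : a + b + (c + d) ≤ j)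
    (hε₁ : ε₁ = 1 ∨ ε₁ = -1) (hε₂ : ε₂ = 1 ∨ ε₂ = -1)
    (hε₃ : ε₃ = 1 ∨ ε₃ = -1) (hε₄ : ε₄ = 1 ∨ ε₄ = -1) :
    a * (2 * (x₁ + m₁) + 1 - a) + b * (ε₁ * (2 * (x₁ - m₁) + 1) - b) +
        (c * (2 * (x₂ + m₂) + 1 - c) + d * (ε₂ * (2 * (x₂ - m₂) + 1) - d)) ≤
      j * u₁ + (x₁ + x₂ + 1 - u₁) ^ 2 + (j * u₂ + (ε₃ * (x₁ - x₂) - u₂) ^ 2) +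
        (j * u₃ + (m₁ + m₂ - u₃) ^ 2) + (j * u₄ + (ε₄ * (m₁ - m₂) - u₄) ^ 2) := by
  have hU : 0 ≤ (j - (a + b + (c + d))) * (u₁ + u₂ + u₃ + u₄) :=
    mul_nonneg (by linarith) (by linarith)
  have s₁ := sq_nonneg (2 * x₁ + 1 + 2 * m₁ - 2 * a - (u₁ + ε₃ * u₂ + (u₃ + ε₄ * u₄)))
  have s₂ := sq_nonneg (2 * x₁ + 1 - 2 * m₁ - 2 * ε₁ * b - (u₁ + ε₃ * u₂ - (u₃ + ε₄ * u₄)))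
  have s₃ := sq_nonneg (2 * x₂ + 1 + 2 * m₂ - 2 * c - (u₁ - ε₃ * u₂ + (u₃ - ε₄ * u₄)))
  have s₄ := sq_nonneg (2 * x₂ + 1 - 2 * m₂ - 2 * ε₂ * d - (u₁ - ε₃ * u₂ - (u₃ - ε₄ * u₄)))
  have t₁ : 0 ≤ a * (u₁ + u₂ + u₃ + u₄ - (u₁ + ε₃ * u₂ + (u₃ + ε₄ * u₄))) := by
    apply mul_nonneg ha
    rcases hε₃ with rfl | rfl <;> rcases hε₄ with rfl | rfl <;> linarith
  have t₂ : 0 ≤ b * (u₁ + u₂ + u₃ + u₄ - ε₁ * (u₁ + ε₃ * u₂ - (u₃ + ε₄ * u₄))) := by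
    apply mul_nonneg hb
    rcases hε₁ with rfl | rfl <;> rcases hε₃ with rfl | rfl <;> rcases hε₄ with rfl | rfl <;>
      linarith
  have t₃ : 0 ≤ c * (u₁ + u₂ + u₃ + u₄ - (u₁ - ε₃ * u₂ + (u₃ - ε₄ * u₄))) := by
    apply mul_nonneg hc
    rcases hε₃ with rfl | rfl <;> rcases hε₄ with rfl | rfl <;> linarith
  have t₄ : 0 ≤ d * (u₁ + u₂ + u₃ + u₄ - ε₂ * (u₁ - ε₃ * u₂ - (u₃ - ε₄ * u₄))) := by
    apply mul_nonneg hd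
    rcases hε₂ with rfl | rfl <;> rcases hε₃ with rfl | rfl <;> rcases hε₄ with rfl | rfl <;>
      linarith
  rcases hε₁ with rfl | rfl <;> rcases hε₂ with rfl | rfl <;> rcases hε₃ with rfl | rfl <;>
    rcases hε₄ with rfl | rfl <;> linarith

/-- combinatorial content of Proposition 4.6(3): the wavefront-set
partition `W₁ ⊔ W₂` is dominated by the C-collapse of `(pᵗ)⁻`, where
`p = [2(m₊⁽¹⁾+m₊⁽²⁾)+1] ⊔ [2|m₊⁽¹⁾-m₊⁽²⁾|-1] ⊔ [2(m₋⁽¹⁾+m₋⁽²⁾)-1] ⊔ [2|m₋⁽¹⁾-m₋⁽²⁾|-1]`. -/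
theorem wavefront_le_dual_no_unitary_case (mp₁ mp₂ mm₁ mm₂ : ℕ)
    (h : ¬ (mp₁ = 0 ∧ mp₂ = 0 ∧ mm₁ = 0 ∧ mm₂ = 0)) :
    ∀ q : Multiset ℕ,
      IsCCollapse
        (pMinus (transposeP
          (strP (2 * (mp₁ + mp₂) + 1) + strP (2 * (max mp₁ mp₂ - min mp₁ mp₂) - 1) +
           strP (2 * (mm₁ + mm₂) - 1) + strP (2 * (max mm₁ mm₂ - min mm₁ mm₂) - 1)))) q →
      DomLE
        ((if mm₁ ≤ mp₁ then strP (2 * (mp₁ + mm₁)) + strP (2 * (mp₁ - mm₁))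
          else strP (2 * (mp₁ + mm₁)) + strP (2 * (mm₁ - mp₁ - 1))) +
         (if mm₂ ≤ mp₂ then strP (2 * (mp₂ + mm₂)) + strP (2 * (mp₂ - mm₂))
          else strP (2 * (mp₂ + mm₂)) + strP (2 * (mm₂ - mp₂ - 1)))) q := by
  intro q hq
  set p := strP (2 * (mp₁ + mp₂) + 1) + strP (2 * (max mp₁ mp₂ - min mp₁ mp₂) - 1) +
    strP (2 * (mm₁ + mm₂) - 1) + strP (2 * (max mm₁ mm₂ - min mm₁ mm₂) - 1) with hp
  rw [show 2 * (mp₁ + mp₂) + 1 = 2 * (mp₁ + mp₂ + 1) - 1 by omega] at hp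
  change DomLE (pairPart mp₁ mm₁ + pairPart mp₂ mm₂) q
  obtain ⟨ε₃, hε₃, hd⟩ := exists_sign_mul_eq_max_sub_min mp₁ mp₂
  obtain ⟨ε₄, hε₄, he⟩ := exists_sign_mul_eq_max_sub_min mm₁ mm₂
  have hmem : ∀ x ∈ pairPart mp₁ mm₁ + pairPart mp₂ mm₂, Even x ∧ 0 < x := fun x hx =>
    (Multiset.mem_add.1 hx).elim even_pos_of_mem_pairPart even_pos_of_mem_pairPart
  have hsum : (pairPart mp₁ mm₁ + pairPart mp₂ mm₂).sum + 1 = p.sum := by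
    rw [hp]
    simp only [Multiset.sum_add, sum_pairPart, sum_strP_odd]
    zify
    rw [hd, he]
    rcases hε₃ with rfl | rfl <;> rcases hε₄ with rfl | rfl <;> ring
  have hP := isPartition_transposeP p
  refine hq.2.2.2.2 _ (fun x hx => (hmem x hx).2) (fun x hx => ?_) ?_ fun j => ?_
  · rw [Multiset.count_eq_zero_of_notMem fun hm => (Nat.not_even_iff_odd.2 hx) (hmem x hm).1]
    exact Even.zero
  · rw [sum_pMinus hP, sum_transposeP]
    omega
  · refine le_trans (le_min ?_ ?_) (min_topSum_le_topSum_pMinus hP j)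
    · refine le_trans ?_ (sum_min_le_topSum_transposeP p j)
      obtain ⟨T, hT, hcard, hTs⟩ :=
        exists_le_sum_eq_topSum (pairPart mp₁ mm₁ + pairPart mp₂ mm₂) j
      obtain ⟨T₁, hT₁, T₂, hT₂, rfl⟩ := Multiset.exists_add_eq_of_le_add hT
      obtain ⟨a, b, ε₁, hε₁, hc₁, hs₁⟩ := exists_sum_le_of_le_pairPart hT₁
      obtain ⟨c, d, ε₂, hε₂, hc₂, hs₂⟩ := exists_sum_le_of_le_pairPart hT₂
      obtain ⟨u₁, hu₁⟩ := exists_sum_min_strP_odd (mp₁ + mp₂ + 1) j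
      obtain ⟨u₂, hu₂⟩ := exists_sum_min_strP_odd (max mp₁ mp₂ - min mp₁ mp₂) j
      obtain ⟨u₃, hu₃⟩ := exists_sum_min_strP_odd (mm₁ + mm₂) j
      obtain ⟨u₄, hu₄⟩ := exists_sum_min_strP_odd (max mm₁ mm₂ - min mm₁ mm₂) j
      rw [Multiset.card_add, hc₁, hc₂] at hcard
      have key := quadratic_bound (x₁ := mp₁) (x₂ := mp₂) (m₁ := mm₁) (m₂ := mm₂)
        (Int.natCast_nonneg a) (Int.natCast_nonneg b) (Int.natCast_nonneg c)
        (Int.natCast_nonneg d) (Int.natCast_nonneg u₁) (Int.natCast_nonneg u₂)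
        (Int.natCast_nonneg u₃) (Int.natCast_nonneg u₄) (j := j) (by exact_mod_cast hcard)
        hε₁ hε₂ hε₃ hε₄
      rw [← hTs, hp]
      simp only [Multiset.map_add, Multiset.sum_add]
      rw [hd] at hu₂
      rw [he] at hu₄
      simp only [Nat.cast_add, Nat.cast_one] at hu₁ hu₃
      rw [← Nat.cast_le (α := ℤ)]
      simp only [Nat.cast_add]
      rw [hu₁, hu₂, hu₃, hu₄]
      linarith
    · rw [sum_transposeP, ← hsum, Nat.add_sub_cancel]
      obtain ⟨T, hT, -, hTs⟩ :=
        exists_le_sum_eq_topSum (pairPart mp₁ mm₁ + pairPart mp₂ mm₂) j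
      rw [← hTs]
      obtain ⟨R, hR⟩ := Multiset.le_iff_exists_add.1 hT
      rw [hR, Multiset.sum_add]
      exact Nat.le_add_right _ _
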